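/- Let N₁, N₂ ∈ ℝ⁸ be orthonormal vectors, V = {x ∈ ℝ⁸ : ⟨x,N₁⟩ = ⟨x,N₂⟩ = 0}, Jx = P(N₁,N₂,x) for x ∈ V, and ω(x,y) = ⟨x, Jy⟩ for x, y ∈ V. Then for all x₁,…,x₆ ∈ V: ((N₁⌟Φ)∧(N₂⌟Φ))(x₁,…,x₆) = −(2σ/3)(ω∧ω∧ω)(x₁,…,x₆). (Pointwise form of the volume relation −4σ Vol₆ = f*(N₁⌟Φ)∧f*(N₂⌟Φ), where 6 Vol₆ = ω∧ω∧ω, for the structure induced on a 6-dimensional submanifold of a Spin(7)-manifold.) -/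

import Mathlib

open scoped BigOperators RealInnerProductSpace

noncomputable section

abbrev Form (n p : ℕ) := (Fin p → EuclideanSpace ℝ (Fin n)) → ℝ

namespace Form

/-- Wedge product of forms (shuffle convention; full antisymmetrization divided by p!q!). -/
def wedge {n p q : ℕ} (α : Form n p) (β : Form n q) : Form n (p + q) :=
  fun x =>
    (((p.factorial * q.factorial : ℕ) : ℝ))⁻¹ *
      ∑ σ : Equiv.Perm (Fin (p + q)),
        ((Equiv.Perm.sign σ : ℤ) : ℝ) *
          (α fun i => x (σ (Fin.castAdd q i))) * (β fun j => x (σ (Fin.natAdd p j)))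

/-- Inner product of `p`-forms. -/
def inner' {n p : ℕ} (α β : Form n p) : ℝ :=
  ((p.factorial : ℕ) : ℝ)⁻¹ *
    ∑ f : Fin p → Fin n,
      (α fun k => EuclideanSpace.single (f k) 1) * (β fun k => EuclideanSpace.single (f k) 1)

/-- Interior product of a vector and a form. -/
def iprod {n p : ℕ} (v : EuclideanSpace ℝ (Fin n)) (α : Form n (p + 1)) : Form n p :=
  fun x => α (Fin.cons v x)

end Form

infixl:72 " ⋏ " => Form.wedge

/-- The 1-form dual to a vector. -/
def dual {n : ℕ} (v : EuclideanSpace ℝ (Fin n)) : Form n 1 := fun x => ⟪v, x 0⟫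

abbrev E8 := EuclideanSpace ℝ (Fin 8)

/-- The basis vector `e`. -/
def e8 : E8 := EuclideanSpace.single 7 1

/-- The basis vectors `e₀,…,e₆` indexed mod 7. -/
def u7 (i : ZMod 7) : E8 := EuclideanSpace.single ⟨i.val, i.val_lt.trans (by norm_num)⟩ 1

/-- The basis indexed by ℤ₈, with `e₇ = e`. -/
def u8 (i : ZMod 8) : E8 := EuclideanSpace.single ⟨i.val, i.val_lt⟩ 1

/-- The Spin(7) fundamental 4-form. -/
def Phi (σ : ℝ) : Form 8 4 := fun x =>
  (∑ i : ZMod 7, (dual e8 ⋏ dual (u7 i) ⋏ dual (u7 (i + 1)) ⋏ dual (u7 (i + 3))) x)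
    - σ * ∑ i : ZMod 7,
        (dual (u7 (i + 2)) ⋏ dual (u7 (i + 4)) ⋏ dual (u7 (i + 5)) ⋏ dual (u7 (i + 6))) x

/-- The standard volume form of ℝ⁸. -/
def vol8 : Form 8 8 :=
  dual e8 ⋏ dual (u7 0) ⋏ dual (u7 1) ⋏ dual (u7 2) ⋏ dual (u7 3) ⋏ dual (u7 4) ⋏ dual (u7 5)
    ⋏ dual (u7 6)

/-- The 2-forms spanning spin(7)ᗮ. -/
def beta (σ : ℝ) (i : ZMod 7) : Form 8 2 := fun x =>
  σ * (dual (u7 i) ⋏ dual e8) x + (dual (u7 (i + 1)) ⋏ dual (u7 (i + 3))) x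
    + (dual (u7 (i + 4)) ⋏ dual (u7 (i + 5))) x + (dual (u7 (i + 2)) ⋏ dual (u7 (i + 6))) x

namespace Form

/-- The signed sum of a form over all permutations of its arguments. -/
def alt {n p : ℕ} (f : Form n p) : Form n p :=
  fun x => ∑ τ : Equiv.Perm (Fin p), ((Equiv.Perm.sign τ : ℤ) : ℝ) * f (x ∘ τ)

/-- The tensor product of two forms. -/
def tensor {n p q : ℕ} (α : Form n p) (β : Form n q) : Form n (p + q) :=
  fun x => α (fun i => x (Fin.castAdd q i)) * β (fun j => x (Fin.natAdd p j))

theorem wedge_eq_smul_alt {n p q : ℕ} (α : Form n p) (β : Form n q) :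
    α ⋏ β = ((p.factorial * q.factorial : ℕ) : ℝ)⁻¹ • alt (tensor α β) := by
  ext x
  simp only [wedge, alt, tensor, Pi.smul_apply, smul_eq_mul, Function.comp_apply, mul_assoc]

theorem alt_smul {n p : ℕ} (c : ℝ) (f : Form n p) : alt (c • f) = c • alt f := by
  ext x
  simp only [alt, Pi.smul_apply, smul_eq_mul, Finset.mul_sum]
  exact Finset.sum_congr rfl fun τ _ => by ring

theorem smul_tensor {n p q : ℕ} (c : ℝ) (f : Form n p) (g : Form n q) :
    tensor (c • f) g = c • tensor f g := by
  ext x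
  simp only [tensor, Pi.smul_apply, smul_eq_mul, mul_assoc]

theorem alt_alt_tensor {n p q : ℕ} (f : Form n p) (g : Form n q) :
    alt (tensor (alt f) g) = (p.factorial : ℝ) • alt (tensor f g) := by
  ext x
  simp only [alt, tensor, Pi.smul_apply, smul_eq_mul, Finset.sum_mul, Finset.mul_sum]
  rw [Finset.sum_comm]
  have h : ∀ τ : Equiv.Perm (Fin p),
      ∑ ρ : Equiv.Perm (Fin (p + q)), ((Equiv.Perm.sign ρ : ℤ) : ℝ) *
        (((Equiv.Perm.sign τ : ℤ) : ℝ) * f ((fun i => (x ∘ ρ) (Fin.castAdd q i)) ∘ τ) *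
          g (fun j => (x ∘ ρ) (Fin.natAdd p j)))
      = ∑ ρ : Equiv.Perm (Fin (p + q)), ((Equiv.Perm.sign ρ : ℤ) : ℝ) *
        (f (fun i => (x ∘ ρ) (Fin.castAdd q i)) * g (fun j => (x ∘ ρ) (Fin.natAdd p j))) := by
    intro τ
    let κ : Equiv.Perm (Fin (p + q)) := finSumFinEquiv.permCongr (Equiv.Perm.sumCongr τ 1)
    refine Fintype.sum_equiv (Equiv.mulRight κ) _ _ fun ρ => ?_
    have h₁ : (fun i => (x ∘ ρ) (Fin.castAdd q i)) ∘ τ = fun i =>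
        (x ∘ ⇑(ρ * κ)) (Fin.castAdd q i) := by
      ext1 i
      simp [κ]
    have h₂ : (fun j => (x ∘ ρ) (Fin.natAdd p j)) = fun j =>
        (x ∘ ⇑(ρ * κ)) (Fin.natAdd p j) := by
      ext1 j
      simp [κ]
    rw [h₁, h₂]
    simp only [Equiv.coe_mulRight, Equiv.Perm.sign_mul, κ, Equiv.Perm.sign_permCongr,
      Equiv.Perm.sign_sumCongr, Equiv.Perm.sign_one, mul_one, Units.val_mul, Int.cast_mul]
    ring
  rw [Finset.sum_congr rfl fun τ _ => h τ, Finset.sum_const, Finset.card_univ,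
    Fintype.card_perm, Fintype.card_fin, nsmul_eq_mul, Finset.mul_sum]

/-- The tensor product of multilinear forms as a multilinear map. -/
def tensorMultilinear {n p q : ℕ}
    (a : MultilinearMap ℝ (fun _ : Fin p => EuclideanSpace ℝ (Fin n)) ℝ)
    (b : MultilinearMap ℝ (fun _ : Fin q => EuclideanSpace ℝ (Fin n)) ℝ) :
    MultilinearMap ℝ (fun _ : Fin (p + q) => EuclideanSpace ℝ (Fin n)) ℝ :=
  ((LinearMap.mul' ℝ ℝ).compMultilinearMap (MultilinearMap.domCoprod a b)).domDomCongr
    finSumFinEquiv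

/-- The wedge product of multilinear forms as an alternating map. -/
def wedgeAlternating {n p q : ℕ}
    (a : MultilinearMap ℝ (fun _ : Fin p => EuclideanSpace ℝ (Fin n)) ℝ)
    (b : MultilinearMap ℝ (fun _ : Fin q => EuclideanSpace ℝ (Fin n)) ℝ) :
    EuclideanSpace ℝ (Fin n) [⋀^Fin (p + q)]→ₗ[ℝ] ℝ :=
  ((p.factorial * q.factorial : ℕ) : ℝ)⁻¹ • MultilinearMap.alternatization (tensorMultilinear a b)

theorem coe_wedgeAlternating {n p q : ℕ}
    (a : MultilinearMap ℝ (fun _ : Fin p => EuclideanSpace ℝ (Fin n)) ℝ)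
    (b : MultilinearMap ℝ (fun _ : Fin q => EuclideanSpace ℝ (Fin n)) ℝ) :
    ⇑(wedgeAlternating a b) = (⇑a : Form n p) ⋏ (⇑b : Form n q) := by
  ext x
  simp only [wedgeAlternating, wedge, AlternatingMap.smul_apply, smul_eq_mul,
    MultilinearMap.alternatization_apply, MultilinearMap.domDomCongr_apply, tensorMultilinear,
    LinearMap.compMultilinearMap_apply, MultilinearMap.domCoprod_apply, LinearMap.mul'_apply,
    finSumFinEquiv_apply_left, finSumFinEquiv_apply_right, Units.smul_def, zsmul_eq_mul, mul_assoc]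

end Form

/-- The wedge product of four covectors is a determinant. -/
theorem wedge_dual_eq_det {n : ℕ} (u : Fin 4 → EuclideanSpace ℝ (Fin n))
    (x : Fin 4 → EuclideanSpace ℝ (Fin n)) :
    (dual (u 0) ⋏ dual (u 1) ⋏ dual (u 2) ⋏ dual (u 3)) x
      = (Matrix.of fun i j => ⟪u j, x i⟫).det := by
  have h : dual (u 0) ⋏ dual (u 1) ⋏ dual (u 2) ⋏ dual (u 3)
      = Form.alt (Form.tensor (Form.tensor (Form.tensor (dual (u 0)) (dual (u 1))) (dual (u 2)))
        (dual (u 3))) := by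
    simp only [Form.wedge_eq_smul_alt, Form.smul_tensor, Form.alt_smul, Form.alt_alt_tensor,
      smul_smul]
    norm_num [Nat.factorial]
  rw [h, Matrix.det_apply]
  refine Finset.sum_congr rfl fun τ _ => ?_
  rw [Fin.prod_univ_four, Units.smul_def, zsmul_eq_mul]
  rfl

/-- The Kronecker symbol. -/
def kron (p i : Fin 8) : ℤ := if p = i then 1 else 0

theorem ite_eq_kron_mul (p i : Fin 8) (c : ℤ) : (if p = i then c else 0) = kron p i * c := by
  simp [kron]

theorem inner_single_single (p i : Fin 8) :
    ⟪(EuclideanSpace.single p 1 : E8), EuclideanSpace.single i 1⟫ = ((kron p i : ℤ) : ℝ) := by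
  simp [kron, EuclideanSpace.inner_single_left]

/-- The value of a wedge product of two basis covectors on two basis vectors. -/
def kron₂ (p q i j : Fin 8) : ℤ :=
  (if p = i then kron q j else 0) - (if p = j then kron q i else 0)

/-- The value of a wedge product of three basis covectors on three basis vectors. -/
def kron₃ (p q r i j k : Fin 8) : ℤ :=
  (if p = i then kron₂ q r j k else 0) - (if p = j then kron₂ q r i k else 0)
    + (if p = k then kron₂ q r i j else 0)

/-- The value of a wedge product of four basis covectors on four basis vectors. -/
def kron₄ (p q r s i j k l : Fin 8) : ℤ :=
  (if p = i then kron₃ q r s j k l else 0) - (if p = j then kron₃ q r s i k l else 0)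
    + (if p = k then kron₃ q r s i j l else 0) - (if p = l then kron₃ q r s i j k else 0)

theorem wedge_dual_single (p q r s i j k l : Fin 8) :
    (dual (EuclideanSpace.single p 1 : E8) ⋏ dual (EuclideanSpace.single q 1)
      ⋏ dual (EuclideanSpace.single r 1) ⋏ dual (EuclideanSpace.single s 1))
        ![EuclideanSpace.single i 1, EuclideanSpace.single j 1, EuclideanSpace.single k 1,
          EuclideanSpace.single l 1] = ((kron₄ p q r s i j k l : ℤ) : ℝ) := by
  refine (wedge_dual_eq_det ![EuclideanSpace.single p 1, EuclideanSpace.single q 1,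
    EuclideanSpace.single r 1, EuclideanSpace.single s 1] _).trans ?_
  simp [Matrix.det_succ_column_zero, Fin.sum_univ_succ, Fin.succAbove, inner_single_single, kron₄,
    kron₃, kron₂, ite_eq_kron_mul]
  ring

/-- The coefficient of `Φ` on the increasing quadruple of basis vectors encoded by a bit mask. -/
def cayleySign (s : ℤ) : ℕ → ℤ
  | 139 => -1 | 150 => -1 | 172 => -1 | 216 => -1 | 177 => -1 | 226 => -1 | 197 => -1
  | 39 => s | 83 => -s | 29 => -s | 105 => s | 78 => s | 58 => -s | 116 => -s
  | _ => 0

/-- The coefficients of `Φ` in the standard basis. -/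
def cayleyCoeff (s : ℤ) (i j k l : Fin 8) : ℤ :=
  Int.sign (((j : ℤ) - i) * (k - i) * (l - i) * (k - j) * (l - j) * (l - k))
    * cayleySign s (2 ^ i.val + 2 ^ j.val + 2 ^ k.val + 2 ^ l.val)

set_option maxRecDepth 100000 in
theorem sum_kron₄_eq_cayleyCoeff : ∀ s ∈ [(1 : ℤ), -1], ∀ i j k l : Fin 8,
    (kron₄ 7 0 1 3 i j k l + kron₄ 7 1 2 4 i j k l + kron₄ 7 2 3 5 i j k l
        + kron₄ 7 3 4 6 i j k l + kron₄ 7 4 5 0 i j k l + kron₄ 7 5 6 1 i j k l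
        + kron₄ 7 6 0 2 i j k l)
      - s * (kron₄ 2 4 5 6 i j k l + kron₄ 3 5 6 0 i j k l + kron₄ 4 6 0 1 i j k l
        + kron₄ 5 0 1 2 i j k l + kron₄ 6 1 2 3 i j k l + kron₄ 0 2 3 4 i j k l
        + kron₄ 1 3 4 5 i j k l)
      = cayleyCoeff s i j k l := by
  decide +kernel

/-- The `4`-form `Φ` as an alternating map. -/
def PhiAlternating (σ : ℝ) : E8 [⋀^Fin 4]→ₗ[ℝ] ℝ :=
  let W (u : Fin 4 → E8) : E8 [⋀^Fin 4]→ₗ[ℝ] ℝ :=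
    Matrix.detRowAlternating.compLinearMap (LinearMap.pi fun j => innerₛₗ ℝ (u j))
  (∑ i : ZMod 7, W ![e8, u7 i, u7 (i + 1), u7 (i + 3)])
    - σ • ∑ i : ZMod 7, W ![u7 (i + 2), u7 (i + 4), u7 (i + 5), u7 (i + 6)]

theorem coe_PhiAlternating (σ : ℝ) : ⇑(PhiAlternating σ) = Phi σ := by
  ext x
  have h (u : Fin 4 → E8) : (dual (u 0) ⋏ dual (u 1) ⋏ dual (u 2) ⋏ dual (u 3)) x
      = Matrix.detRowAlternating.compLinearMap (LinearMap.pi fun j => innerₛₗ ℝ (u j)) x :=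
    wedge_dual_eq_det u x
  have hsum (f : ZMod 7 → E8 [⋀^Fin 4]→ₗ[ℝ] ℝ) : (∑ i, f i) x = ∑ i, f i x :=
    map_sum (⟨⟨fun g => g x, rfl⟩, fun _ _ => rfl⟩ : (E8 [⋀^Fin 4]→ₗ[ℝ] ℝ) →+ ℝ) f Finset.univ
  simp only [PhiAlternating, Phi, AlternatingMap.sub_apply, AlternatingMap.smul_apply,
    hsum, smul_eq_mul, ← h]
  rfl

theorem Phi_single {σ : ℝ} {s : ℤ} (hs : s ∈ [(1 : ℤ), -1]) (hσ : σ = s) (i j k l : Fin 8) :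
    Phi σ ![EuclideanSpace.single i 1, EuclideanSpace.single j 1, EuclideanSpace.single k 1,
      EuclideanSpace.single l 1] = ((cayleyCoeff s i j k l : ℤ) : ℝ) := by
  have hsum (f : ZMod 7 → ℝ) : ∑ i, f i = f 0 + f 1 + f 2 + f 3 + f 4 + f 5 + f 6 :=
    Fin.sum_univ_seven f
  rw [← sum_kron₄_eq_cayleyCoeff s hs i j k l, Phi, hsum, hsum, hσ]
  push_cast
  simp only [← wedge_dual_single]
  rfl

section PhiAlgebra

variable (σ : ℝ) (x y z w : E8)

theorem Phi_swap₁₂ : Phi σ ![y, x, z, w] = -Phi σ ![x, y, z, w] := by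
  rw [← coe_PhiAlternating, ← (PhiAlternating σ).map_swap ![x, y, z, w]
    (show (0 : Fin 4) ≠ 1 by decide)]
  congr 1
  ext i : 1
  fin_cases i <;> rfl

theorem Phi_swap₂₃ : Phi σ ![x, z, y, w] = -Phi σ ![x, y, z, w] := by
  rw [← coe_PhiAlternating, ← (PhiAlternating σ).map_swap ![x, y, z, w]
    (show (1 : Fin 4) ≠ 2 by decide)]
  congr 1
  ext i : 1
  fin_cases i <;> rfl

theorem Phi_swap₃₄ : Phi σ ![x, y, w, z] = -Phi σ ![x, y, z, w] := by
  rw [← coe_PhiAlternating, ← (PhiAlternating σ).map_swap ![x, y, z, w]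
    (show (2 : Fin 4) ≠ 3 by decide)]
  congr 1
  ext i : 1
  fin_cases i <;> rfl

theorem Phi_add (x' : E8) :
    Phi σ ![x + x', y, z, w] = Phi σ ![x, y, z, w] + Phi σ ![x', y, z, w] := by
  rw [← coe_PhiAlternating]
  generalize PhiAlternating σ = F
  exact F.map_vecCons_add ![y, z, w] x x'

theorem Phi_smul (c : ℝ) : Phi σ ![c • x, y, z, w] = c * Phi σ ![x, y, z, w] := by
  rw [← coe_PhiAlternating]
  generalize PhiAlternating σ = F
  exact F.map_vecCons_smul ![y, z, w] c x

end PhiAlgebra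

/-- A trilinear alternating function vanishing on increasing triples of basis vectors is zero. -/
theorem eq_zero_of_alternating (f : E8 → E8 → E8 → ℝ) (hf : ∀ y z, IsLinearMap ℝ fun x => f x y z)
    (h₁₂ : ∀ x y z, f y x z = -f x y z) (h₂₃ : ∀ x y z, f x z y = -f x y z)
    (h : ∀ i j k : Fin 8, i < j → j < k → f (EuclideanSpace.single i 1)
      (EuclideanSpace.single j 1) (EuclideanSpace.single k 1) = 0) (x y z : E8) :
    f x y z = 0 := by
  have hb (g : E8 → ℝ) (hg : IsLinearMap ℝ g)
      (h0 : ∀ i : Fin 8, g (EuclideanSpace.single i 1) = 0) (v : E8) : g v = 0 := by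
    have : hg.mk' g = 0 :=
      (EuclideanSpace.basisFun (Fin 8) ℝ).toBasis.ext fun i => by simpa using h0 i
    exact LinearMap.congr_fun this v
  have h0 (y : E8) (x) : f x x y = 0 := by linarith [h₁₂ x x y]
  have h0' (y : E8) (x) : f y x x = 0 := by linarith [h₂₃ y x x]
  refine hb _ (hf y z) (fun i => ?_) x
  rw [← neg_eq_zero, ← h₁₂]
  refine hb _ (hf _ z) (fun j => ?_) y
  rw [h₁₂, neg_eq_zero, ← neg_eq_zero, ← h₂₃, ← neg_eq_zero, ← h₁₂]
  refine hb _ (hf _ _) (fun k => ?_) z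
  have key : ∀ i j k : Fin 8, i < j → f (EuclideanSpace.single i 1)
      (EuclideanSpace.single j 1) (EuclideanSpace.single k 1) = 0 := by
    intro i j k hij
    rcases lt_trichotomy j k with hjk | rfl | hjk
    · exact h i j k hij hjk
    · exact h0' _ _
    · rcases lt_trichotomy i k with hik | rfl | hik
      · rw [h₂₃, h i k j hik hjk, neg_zero]
      · rw [h₂₃, h0, neg_zero]
      · rw [h₂₃, h₁₂, h k i j hik hij, neg_zero, neg_zero]
  rw [h₁₂, h₂₃, neg_neg]
  rcases lt_trichotomy i j with hij | rfl | hij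
  · exact key i j k hij
  · exact h0 _ _
  · rw [h₁₂, key j i k hij, neg_zero]

/-- The coordinates of the contraction of `Φ` with itself in one argument. -/
def cayleyContraction (s : ℤ) (i j k a b c : Fin 8) : ℤ :=
  kron₃ i j k a b c
    - s * (kron i a * cayleyCoeff s j k b c + kron i b * cayleyCoeff s j k c a
      + kron i c * cayleyCoeff s j k a b + kron j a * cayleyCoeff s k i b c
      + kron j b * cayleyCoeff s k i c a + kron j c * cayleyCoeff s k i a b
      + kron k a * cayleyCoeff s i j b c + kron k b * cayleyCoeff s i j c a
      + kron k c * cayleyCoeff s i j a b)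

set_option maxRecDepth 100000 in
theorem sum_cayleyCoeff_mul : ∀ s ∈ [(1 : ℤ), -1], ∀ i j k : Fin 8, i < j → j < k →
    ∀ a b c : Fin 8, a < b → b < c →
    ∑ m, cayleyCoeff s i j k m * cayleyCoeff s a b c m = cayleyContraction s i j k a b c := by
  decide +kernel

section CrossProduct

variable {σ : ℝ} {P : E8 → E8 → E8 → E8}

theorem cross_swap₁₂ (hP : ∀ x y z w : E8, ⟪P x y z, w⟫ = Phi σ ![x, y, z, w]) (x y z : E8) :
    P y x z = -P x y z := by
  refine ext_inner_right ℝ fun w => ?_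
  rw [inner_neg_left, hP, hP, Phi_swap₁₂]

theorem cross_swap₂₃ (hP : ∀ x y z w : E8, ⟪P x y z, w⟫ = Phi σ ![x, y, z, w]) (x y z : E8) :
    P x z y = -P x y z := by
  refine ext_inner_right ℝ fun w => ?_
  rw [inner_neg_left, hP, hP, Phi_swap₂₃]

theorem cross_add (hP : ∀ x y z w : E8, ⟪P x y z, w⟫ = Phi σ ![x, y, z, w]) (x x' y z : E8) :
    P (x + x') y z = P x y z + P x' y z := by
  refine ext_inner_right ℝ fun w => ?_
  rw [inner_add_left, hP, hP, hP, Phi_add]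

theorem cross_smul (hP : ∀ x y z w : E8, ⟪P x y z, w⟫ = Phi σ ![x, y, z, w]) (c : ℝ)
    (x y z : E8) : P (c • x) y z = c • P x y z := by
  refine ext_inner_right ℝ fun w => ?_
  rw [real_inner_smul_left, hP, hP, Phi_smul]

/-- The inner product of two triple cross products. -/
theorem inner_cross_cross (hσ : σ = 1 ∨ σ = -1)
    (hP : ∀ x y z w : E8, ⟪P x y z, w⟫ = Phi σ ![x, y, z, w]) (x y z a b c : E8) :
    ⟪P x y z, P a b c⟫
      = ⟪x, a⟫ * (⟪y, b⟫ * ⟪z, c⟫ - ⟪y, c⟫ * ⟪z, b⟫) - ⟪x, b⟫ * (⟪y, a⟫ * ⟪z, c⟫ - ⟪y, c⟫ * ⟪z, a⟫)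
        + ⟪x, c⟫ * (⟪y, a⟫ * ⟪z, b⟫ - ⟪y, b⟫ * ⟪z, a⟫)
        - σ * (⟪x, a⟫ * Phi σ ![y, z, b, c] + ⟪x, b⟫ * Phi σ ![y, z, c, a]
          + ⟪x, c⟫ * Phi σ ![y, z, a, b] + ⟪y, a⟫ * Phi σ ![z, x, b, c]
          + ⟪y, b⟫ * Phi σ ![z, x, c, a] + ⟪y, c⟫ * Phi σ ![z, x, a, b]
          + ⟪z, a⟫ * Phi σ ![x, y, b, c] + ⟪z, b⟫ * Phi σ ![x, y, c, a]
          + ⟪z, c⟫ * Phi σ ![x, y, a, b]) := by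
  let F : E8 → E8 → E8 → E8 → E8 → E8 → ℝ := fun x y z a b c => ⟪P x y z, P a b c⟫
    - (⟪x, a⟫ * (⟪y, b⟫ * ⟪z, c⟫ - ⟪y, c⟫ * ⟪z, b⟫)
      - ⟪x, b⟫ * (⟪y, a⟫ * ⟪z, c⟫ - ⟪y, c⟫ * ⟪z, a⟫)
      + ⟪x, c⟫ * (⟪y, a⟫ * ⟪z, b⟫ - ⟪y, b⟫ * ⟪z, a⟫)
      - σ * (⟪x, a⟫ * Phi σ ![y, z, b, c] + ⟪x, b⟫ * Phi σ ![y, z, c, a]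
        + ⟪x, c⟫ * Phi σ ![y, z, a, b] + ⟪y, a⟫ * Phi σ ![z, x, b, c]
        + ⟪y, b⟫ * Phi σ ![z, x, c, a] + ⟪y, c⟫ * Phi σ ![z, x, a, b]
        + ⟪z, a⟫ * Phi σ ![x, y, b, c] + ⟪z, b⟫ * Phi σ ![x, y, c, a]
        + ⟪z, c⟫ * Phi σ ![x, y, a, b]))
  have hF : ∀ x y z a b c, F x y z a b c = ⟪P x y z, P a b c⟫
    - (⟪x, a⟫ * (⟪y, b⟫ * ⟪z, c⟫ - ⟪y, c⟫ * ⟪z, b⟫)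
      - ⟪x, b⟫ * (⟪y, a⟫ * ⟪z, c⟫ - ⟪y, c⟫ * ⟪z, a⟫)
      + ⟪x, c⟫ * (⟪y, a⟫ * ⟪z, b⟫ - ⟪y, b⟫ * ⟪z, a⟫)
      - σ * (⟪x, a⟫ * Phi σ ![y, z, b, c] + ⟪x, b⟫ * Phi σ ![y, z, c, a]
        + ⟪x, c⟫ * Phi σ ![y, z, a, b] + ⟪y, a⟫ * Phi σ ![z, x, b, c]
        + ⟪y, b⟫ * Phi σ ![z, x, c, a] + ⟪y, c⟫ * Phi σ ![z, x, a, b]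
        + ⟪z, a⟫ * Phi σ ![x, y, b, c] + ⟪z, b⟫ * Phi σ ![x, y, c, a]
        + ⟪z, c⟫ * Phi σ ![x, y, a, b])) := fun _ _ _ _ _ _ => rfl
  have pair (x y z w : E8) : Phi σ ![z, w, x, y] = Phi σ ![x, y, z, w] := by
    rw [Phi_swap₂₃, Phi_swap₁₂, Phi_swap₃₄, Phi_swap₂₃, neg_neg, neg_neg]
  have symm (x y z a b c : E8) : F a b c x y z = F x y z a b c := by
    simp only [hF]
    rw [real_inner_comm, pair y z b c, pair y z c a, pair y z a b, pair z x b c, pair z x c a,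
      pair z x a b, pair x y b c, pair x y c a, pair x y a b, real_inner_comm x a,
      real_inner_comm x b, real_inner_comm x c, real_inner_comm y a, real_inner_comm y b,
      real_inner_comm y c, real_inner_comm z a, real_inner_comm z b, real_inner_comm z c]
    ring
  have lin (y z a b c : E8) : IsLinearMap ℝ fun x => F x y z a b c := by
    have hadd₂ (x x' y z w : E8) :
        Phi σ ![y, x + x', z, w] = Phi σ ![y, x, z, w] + Phi σ ![y, x', z, w] := by
      rw [Phi_swap₁₂, Phi_add, neg_add, ← Phi_swap₁₂, ← Phi_swap₁₂]
    have hsmul₂ (r : ℝ) (x y z w : E8) : Phi σ ![y, r • x, z, w] = r * Phi σ ![y, x, z, w] := by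
      rw [Phi_swap₁₂, Phi_smul, ← mul_neg, ← Phi_swap₁₂]
    constructor
    · intro x x'
      simp only [hF, cross_add hP, inner_add_left, Phi_add, hadd₂]
      ring
    · intro r x
      simp only [hF, cross_smul hP, real_inner_smul_left, Phi_smul, hsmul₂, smul_eq_mul]
      ring
  have swap₁₂ (a b c x y z : E8) : F y x z a b c = -F x y z a b c := by
    simp only [hF]
    rw [cross_swap₁₂ hP, inner_neg_left]
    simp only [Phi_swap₁₂ σ z x, Phi_swap₁₂ σ y z, Phi_swap₁₂ σ x y]
    ring
  have swap₂₃ (a b c x y z : E8) : F x z y a b c = -F x y z a b c := by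
    simp only [hF]
    rw [cross_swap₂₃ hP, inner_neg_left]
    simp only [Phi_swap₁₂ σ z x, Phi_swap₁₂ σ y z, Phi_swap₁₂ σ x y]
    ring
  obtain ⟨s, hs, hσs⟩ : ∃ s ∈ [(1 : ℤ), -1], σ = s := by
    rcases hσ with rfl | rfl
    · exact ⟨1, by simp, by simp⟩
    · exact ⟨-1, by simp, by simp⟩
  refine sub_eq_zero.mp ((hF x y z a b c).symm.trans ?_)
  refine eq_zero_of_alternating (F · · · a b c) (lin · · a b c) (swap₁₂ a b c) (swap₂₃ a b c)
    (fun i j k hij hjk => ?_) x y z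
  rw [symm]
  refine eq_zero_of_alternating (F · · · _ _ _) (lin · · _ _ _) (swap₁₂ _ _ _) (swap₂₃ _ _ _)
    (fun p q r hpq hqr => ?_) a b c
  have hPi (i j k m : Fin 8) : P (EuclideanSpace.single i 1) (EuclideanSpace.single j 1)
      (EuclideanSpace.single k 1) m = ((cayleyCoeff s i j k m : ℤ) : ℝ) := by
    rw [← Phi_single hs hσs, ← hP]
    simp [EuclideanSpace.inner_single_right]
  have key := congrArg (Int.cast : ℤ → ℝ) (sum_cayleyCoeff_mul s hs p q r hpq hqr i j k hij hjk)
  simp only [hF, Phi_single hs hσs, inner_single_single]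
  rw [PiLp.inner_apply]
  simp only [hPi, cayleyContraction, kron₃, kron₂, ite_eq_kron_mul] at key ⊢
  push_cast at key
  rw [← hσs] at key
  simp only [RCLike.inner_apply, conj_trivial]
  rw [← sub_eq_zero] at key
  rw [← key]
  simp only [mul_comm]

end CrossProduct

section Phi

variable (σ : ℝ) (x y z w : E8)

theorem Phi_eq_zero {v : Fin 4 → E8} {i j : Fin 4} (h : v i = v j) (hij : i ≠ j) :
    Phi σ v = 0 := by
  rw [← coe_PhiAlternating]
  exact (PhiAlternating σ).map_eq_zero_of_eq v h hij

theorem Phi_self₁₂ : Phi σ ![x, x, y, z] = 0 :=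
  Phi_eq_zero σ (i := 0) (j := 1) rfl (by decide)

theorem Phi_self₁₃ : Phi σ ![x, y, x, z] = 0 :=
  Phi_eq_zero σ (i := 0) (j := 2) rfl (by decide)

theorem Phi_self₁₄ : Phi σ ![x, y, z, x] = 0 :=
  Phi_eq_zero σ (i := 0) (j := 3) rfl (by decide)

theorem Phi_self₂₃ : Phi σ ![y, x, x, z] = 0 :=
  Phi_eq_zero σ (i := 1) (j := 2) rfl (by decide)

theorem Phi_self₂₄ : Phi σ ![y, x, z, x] = 0 :=
  Phi_eq_zero σ (i := 1) (j := 3) rfl (by decide)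

theorem Phi_self₃₄ : Phi σ ![y, z, x, x] = 0 :=
  Phi_eq_zero σ (i := 2) (j := 3) rfl (by decide)

end Phi

section Frame

theorem exists_unit_orthogonal {n : ℕ} (hn : n < 8) (w : Fin n → E8) :
    ∃ v : E8, ⟪v, v⟫ = 1 ∧ ∀ i, ⟪v, w i⟫ = 0 := by
  have hlt : Module.finrank ℝ (Submodule.span ℝ (Set.range w)) < Module.finrank ℝ E8 := by
    have := finrank_range_le_card (R := ℝ) w
    rw [Fintype.card_fin] at this
    rw [finrank_euclideanSpace_fin]
    exact this.trans_lt hn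
  have hne : (Submodule.span ℝ (Set.range w))ᗮ ≠ ⊥ := by
    rw [Ne, Submodule.orthogonal_eq_bot_iff]
    rintro h
    rw [h, finrank_top] at hlt
    exact hlt.false
  obtain ⟨u, hu, hu0⟩ := Submodule.exists_mem_ne_zero_of_ne_bot hne
  have hnorm : ‖u‖ ≠ 0 := norm_ne_zero_iff.mpr hu0
  refine ⟨‖u‖⁻¹ • u, ?_, fun i => ?_⟩
  · rw [real_inner_smul_left, real_inner_smul_right, real_inner_self_eq_norm_sq]
    field_simp
  · rw [real_inner_smul_left, (Submodule.mem_orthogonal' _ _).mp hu _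
      (Submodule.subset_span ⟨i, rfl⟩), mul_zero]

theorem Orthonormal.sum_inner_smul_eq {w : Fin 8 → E8} (hw : Orthonormal ℝ w) (x : E8) :
    ∑ i, ⟪w i, x⟫ • w i = x := by
  have hcard : Fintype.card (Fin 8) = Module.finrank ℝ E8 := by simp
  have hb : ⇑(basisOfOrthonormalOfCardEqFinrank hw hcard) = w :=
    coe_basisOfOrthonormalOfCardEqFinrank hw hcard
  let b := (basisOfOrthonormalOfCardEqFinrank hw hcard).toOrthonormalBasis (by rwa [hb])
  have hbw : ⇑b = w := by rw [Module.Basis.coe_toOrthonormalBasis, hb]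
  have h := b.sum_repr' x
  rwa [hbw] at h

/-- Two alternating maps in `m` arguments which agree on a family of `m` vectors agree on its
span. -/
theorem AlternatingMap.eq_of_mem_span {m : ℕ} {F G : E8 [⋀^Fin m]→ₗ[ℝ] ℝ} {e : Fin m → E8}
    (h : F e = G e) {x : Fin m → E8} (hx : ∀ k, x k ∈ Submodule.span ℝ (Set.range e)) :
    F x = G x := by
  let L := Fintype.linearCombination ℝ e
  have hL (k : Fin m) : ∃ c, L c = x k := by
    have := hx k
    rwa [← Fintype.range_linearCombination, LinearMap.mem_range] at this
  choose c hc using hL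
  have hLe : (fun i => L (Pi.basisFun ℝ (Fin m) i)) = e := by
    ext1 i
    simp [L]
  have hFG : F.compLinearMap L = G.compLinearMap L := by
    rw [(F.compLinearMap L).eq_smul_basis_det (Pi.basisFun ℝ (Fin m)),
      (G.compLinearMap L).eq_smul_basis_det (Pi.basisFun ℝ (Fin m))]
    congr 1
    simp only [AlternatingMap.compLinearMap_apply]
    rw [hLe, h]
  have := congrArg (fun H => H c) hFG
  simpa [hc] using this

end Frame

section ComplexStructure

variable {σ : ℝ} {P : E8 → E8 → E8 → E8} {N₁ N₂ : E8}

theorem inner_J_J (hσ : σ = 1 ∨ σ = -1)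
    (hP : ∀ x y z w : E8, ⟪P x y z, w⟫ = Phi σ ![x, y, z, w])
    (hN₁ : ⟪N₁, N₁⟫ = 1) (hN₂ : ⟪N₂, N₂⟫ = 1) (hN₁₂ : ⟪N₁, N₂⟫ = 0) (w : E8) {x : E8}
    (hx : ⟪x, N₁⟫ = 0 ∧ ⟪x, N₂⟫ = 0) : ⟪P N₁ N₂ w, P N₁ N₂ x⟫ = ⟪w, x⟫ := by
  rw [inner_cross_cross hσ hP, hN₁, hN₂, hN₁₂, real_inner_comm N₁ N₂, hN₁₂, real_inner_comm x N₁,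
    real_inner_comm x N₂, hx.1, hx.2]
  simp only [Phi_self₁₃, Phi_self₁₄, Phi_self₂₃, Phi_self₂₄]
  ring

theorem J_J (hσ : σ = 1 ∨ σ = -1)
    (hP : ∀ x y z w : E8, ⟪P x y z, w⟫ = Phi σ ![x, y, z, w])
    (hN₁ : ⟪N₁, N₁⟫ = 1) (hN₂ : ⟪N₂, N₂⟫ = 1) (hN₁₂ : ⟪N₁, N₂⟫ = 0) {x : E8}
    (hx : ⟪x, N₁⟫ = 0 ∧ ⟪x, N₂⟫ = 0) : P N₁ N₂ (P N₁ N₂ x) = -x := by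
  refine ext_inner_right ℝ fun w => ?_
  rw [hP, Phi_swap₃₄, ← hP, inner_J_J hσ hP hN₁ hN₂ hN₁₂ w hx, inner_neg_left, real_inner_comm]

theorem J_mem (hP : ∀ x y z w : E8, ⟪P x y z, w⟫ = Phi σ ![x, y, z, w]) (x : E8) :
    ⟪P N₁ N₂ x, N₁⟫ = 0 ∧ ⟪P N₁ N₂ x, N₂⟫ = 0 := by
  rw [hP, hP]
  exact ⟨Phi_self₁₄ .., Phi_self₂₄ ..⟩

theorem Phi_J (hσ : σ = 1 ∨ σ = -1)
    (hP : ∀ x y z w : E8, ⟪P x y z, w⟫ = Phi σ ![x, y, z, w])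
    (hN₁ : ⟪N₁, N₁⟫ = 1) (hN₁₂ : ⟪N₁, N₂⟫ = 0) {x y z : E8}
    (hx : ⟪x, N₁⟫ = 0) (hy : ⟪y, N₁⟫ = 0 ∧ ⟪y, N₂⟫ = 0) (hz : ⟪z, N₁⟫ = 0 ∧ ⟪z, N₂⟫ = 0) :
    Phi σ ![N₁, P N₁ N₂ x, y, z] = -σ * Phi σ ![N₂, x, y, z] := by
  rw [Phi_swap₂₃, Phi_swap₃₄, ← hP, inner_cross_cross hσ hP, hN₁, hN₁₂, real_inner_comm x N₁, hx,
    hy.1, hy.2, hz.1, hz.2, Phi_swap₂₃ σ y N₂ z x, Phi_swap₁₂ σ N₂ y z x, Phi_swap₃₄ σ N₂ y x z,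
    Phi_swap₂₃ σ N₂ x y z]
  simp only [Phi_self₁₃, Phi_self₁₄, Phi_self₂₃, Phi_self₂₄]
  ring

end ComplexStructure

section AdaptedFrame

variable {σ : ℝ} {P : E8 → E8 → E8 → E8} {N₁ N₂ : E8}

theorem inner_J_skew (hP : ∀ x y z w : E8, ⟪P x y z, w⟫ = Phi σ ![x, y, z, w]) (x y : E8) :
    ⟪x, P N₁ N₂ y⟫ = -⟪y, P N₁ N₂ x⟫ := by
  rw [real_inner_comm, hP, Phi_swap₃₄, ← hP, real_inner_comm]

/-- The family `v₀, Jv₀, v₁, Jv₁, v₂, Jv₂`. -/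
def complexFrame (J : E8 → E8) (v : Fin 3 → E8) : Fin 6 → E8 :=
  ![v 0, J (v 0), v 1, J (v 1), v 2, J (v 2)]

variable (P N₁ N₂) in
/-- A unitary frame of the orthogonal complement of `N₁` and `N₂`. -/
structure IsUnitaryFrame (v : Fin 3 → E8) : Prop where
  inner_normal : ∀ i, ⟪v i, N₁⟫ = 0 ∧ ⟪v i, N₂⟫ = 0
  inner_self : ∀ i j, ⟪v i, v j⟫ = if i = j then 1 else 0
  inner_J : ∀ i j, ⟪v i, P N₁ N₂ (v j)⟫ = 0

theorem exists_isUnitaryFrame (hP : ∀ x y z w : E8, ⟪P x y z, w⟫ = Phi σ ![x, y, z, w]) :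
    ∃ v, IsUnitaryFrame P N₁ N₂ v := by
  let J := P N₁ N₂
  obtain ⟨v₀, h₀, g₀⟩ := exists_unit_orthogonal (by norm_num) ![N₁, N₂]
  obtain ⟨v₁, h₁, g₁⟩ := exists_unit_orthogonal (by norm_num) ![N₁, N₂, v₀, J v₀]
  obtain ⟨v₂, h₂, g₂⟩ := exists_unit_orthogonal (by norm_num) ![N₁, N₂, v₀, J v₀, v₁, J v₁]
  have hself (x : E8) : ⟪x, J x⟫ = 0 := by linarith [inner_J_skew (N₁ := N₁) (N₂ := N₂) hP x x]
  have h₁₀ : ⟪v₁, v₀⟫ = 0 := g₁ 2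
  have h₂₀ : ⟪v₂, v₀⟫ = 0 := g₂ 2
  have h₂₁ : ⟪v₂, v₁⟫ = 0 := g₂ 4
  have k₁₀ : ⟪v₁, J v₀⟫ = 0 := g₁ 3
  have k₂₀ : ⟪v₂, J v₀⟫ = 0 := g₂ 3
  have k₂₁ : ⟪v₂, J v₁⟫ = 0 := g₂ 5
  have k₀₁ : ⟪v₀, J v₁⟫ = 0 := by rw [inner_J_skew hP, neg_eq_zero]; exact k₁₀
  have k₀₂ : ⟪v₀, J v₂⟫ = 0 := by rw [inner_J_skew hP, neg_eq_zero]; exact k₂₀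
  have k₁₂ : ⟪v₁, J v₂⟫ = 0 := by rw [inner_J_skew hP, neg_eq_zero]; exact k₂₁
  have h₀₁ : ⟪v₀, v₁⟫ = 0 := by rw [real_inner_comm, h₁₀]
  have h₀₂ : ⟪v₀, v₂⟫ = 0 := by rw [real_inner_comm, h₂₀]
  have h₁₂ : ⟪v₁, v₂⟫ = 0 := by rw [real_inner_comm, h₂₁]
  refine ⟨![v₀, v₁, v₂], fun i => ?_, fun i j => ?_, fun i j => ?_⟩
  · fin_cases i
    exacts [⟨g₀ 0, g₀ 1⟩, ⟨g₁ 0, g₁ 1⟩, ⟨g₂ 0, g₂ 1⟩]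
  · fin_cases i <;> fin_cases j
    exacts [h₀, h₀₁, h₀₂, h₁₀, h₁, h₁₂, h₂₀, h₂₁, h₂]
  · fin_cases i <;> fin_cases j
    exacts [hself _, k₀₁, k₀₂, k₁₀, hself _, k₁₂, k₂₀, k₂₁, hself _]

namespace IsUnitaryFrame

variable {v : Fin 3 → E8}

theorem inner_J_J' (hv : IsUnitaryFrame P N₁ N₂ v) (hσ : σ = 1 ∨ σ = -1)
    (hP : ∀ x y z w : E8, ⟪P x y z, w⟫ = Phi σ ![x, y, z, w])
    (hN₁ : ⟪N₁, N₁⟫ = 1) (hN₂ : ⟪N₂, N₂⟫ = 1) (hN₁₂ : ⟪N₁, N₂⟫ = 0) (i j : Fin 3) :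
    ⟪P N₁ N₂ (v i), P N₁ N₂ (v j)⟫ = if i = j then 1 else 0 := by
  rw [inner_J_J hσ hP hN₁ hN₂ hN₁₂ _ (hv.inner_normal j), hv.inner_self]

theorem orthonormal (hv : IsUnitaryFrame P N₁ N₂ v) (hσ : σ = 1 ∨ σ = -1)
    (hP : ∀ x y z w : E8, ⟪P x y z, w⟫ = Phi σ ![x, y, z, w])
    (hN₁ : ⟪N₁, N₁⟫ = 1) (hN₂ : ⟪N₂, N₂⟫ = 1) (hN₁₂ : ⟪N₁, N₂⟫ = 0) :
    Orthonormal ℝ (Fin.cons N₁ (Fin.cons N₂ (complexFrame (P N₁ N₂) v)) : Fin 8 → E8) := by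
  have hJJ := hv.inner_J_J' hσ hP hN₁ hN₂ hN₁₂
  have h₁ i := (hv.inner_normal i).1
  have h₂ i := (hv.inner_normal i).2
  have h₁' i : ⟪N₁, v i⟫ = 0 := by rw [real_inner_comm, h₁]
  have h₂' i : ⟪N₂, v i⟫ = 0 := by rw [real_inner_comm, h₂]
  have g₁ x := (J_mem (N₁ := N₁) (N₂ := N₂) hP x).1
  have g₂ x := (J_mem (N₁ := N₁) (N₂ := N₂) hP x).2
  have g₁' x : ⟪N₁, P N₁ N₂ x⟫ = 0 := by rw [real_inner_comm, g₁]
  have g₂' x : ⟪N₂, P N₁ N₂ x⟫ = 0 := by rw [real_inner_comm, g₂]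
  have k := hv.inner_J
  have k' i j : ⟪P N₁ N₂ (v i), v j⟫ = 0 := by rw [real_inner_comm, k]
  have hN₂₁ : ⟪N₂, N₁⟫ = 0 := by rw [real_inner_comm, hN₁₂]
  change Orthonormal ℝ ![N₁, N₂, v 0, P N₁ N₂ (v 0), v 1, P N₁ N₂ (v 1), v 2, P N₁ N₂ (v 2)]
  rw [orthonormal_iff_ite]
  intro i j
  fin_cases i <;> fin_cases j <;>
    simp [hJJ, h₁, h₂, h₁', h₂', g₁, g₂, g₁', g₂', k, k', hN₁, hN₂, hN₁₂,
      hN₂₁, hv.inner_self, -inner_self_eq_norm_sq_to_K]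

theorem mem_span (hv : IsUnitaryFrame P N₁ N₂ v) (hσ : σ = 1 ∨ σ = -1)
    (hP : ∀ x y z w : E8, ⟪P x y z, w⟫ = Phi σ ![x, y, z, w])
    (hN₁ : ⟪N₁, N₁⟫ = 1) (hN₂ : ⟪N₂, N₂⟫ = 1) (hN₁₂ : ⟪N₁, N₂⟫ = 0) {x : E8}
    (hx : ⟪x, N₁⟫ = 0 ∧ ⟪x, N₂⟫ = 0) :
    x ∈ Submodule.span ℝ (Set.range (complexFrame (P N₁ N₂) v)) := by
  have h := (hv.orthonormal hσ hP hN₁ hN₂ hN₁₂).sum_inner_smul_eq x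
  rw [Fin.sum_univ_succ, Fin.sum_univ_succ] at h
  simp only [Fin.cons_zero, Fin.cons_succ] at h
  rw [real_inner_comm x N₁, real_inner_comm x N₂, hx.1, hx.2, zero_smul, zero_smul, zero_add,
    zero_add] at h
  rw [← h]
  exact Submodule.sum_mem _ fun i _ => Submodule.smul_mem _ _ (Submodule.subset_span ⟨i, rfl⟩)

/-- The complex volume form has unit length on a unitary frame. -/
theorem Phi_sq_add_Phi_sq (hv : IsUnitaryFrame P N₁ N₂ v) (hσ : σ = 1 ∨ σ = -1)
    (hP : ∀ x y z w : E8, ⟪P x y z, w⟫ = Phi σ ![x, y, z, w])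
    (hN₁ : ⟪N₁, N₁⟫ = 1) (hN₂ : ⟪N₂, N₂⟫ = 1) (hN₁₂ : ⟪N₁, N₂⟫ = 0) :
    Phi σ ![N₁, v 0, v 1, v 2] ^ 2 + Phi σ ![N₂, v 0, v 1, v 2] ^ 2 = 1 := by
  have hpp : ⟪P (v 0) (v 1) (v 2), P (v 0) (v 1) (v 2)⟫ = 1 := by
    rw [inner_cross_cross hσ hP]
    simp [hv.inner_self, Phi_self₁₃, Phi_self₁₄, Phi_self₂₃, -inner_self_eq_norm_sq_to_K]
  have hJ (i : Fin 3) : ⟪P (v 0) (v 1) (v 2), P N₁ N₂ (v i)⟫ = 0 := by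
    have hω (a b : Fin 3) : Phi σ ![v a, v b, N₁, N₂] = 0 := by
      rw [Phi_swap₂₃, Phi_swap₁₂, Phi_swap₃₄, Phi_swap₂₃, ← hP, real_inner_comm, hv.inner_J]
      norm_num
    rw [inner_cross_cross hσ hP]
    simp [hv.inner_normal, hω]
  have h := congrArg (fun u => ⟪u, P (v 0) (v 1) (v 2)⟫)
    ((hv.orthonormal hσ hP hN₁ hN₂ hN₁₂).sum_inner_smul_eq (P (v 0) (v 1) (v 2)))
  simp only [sum_inner, real_inner_smul_left, hpp] at h
  have hN (N : E8) : ⟪N, P (v 0) (v 1) (v 2)⟫ = -Phi σ ![N, v 0, v 1, v 2] := by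
    rw [real_inner_comm, hP, Phi_swap₃₄, Phi_swap₂₃, Phi_swap₁₂, neg_neg]
  simp only [hN] at h
  have hself (i : Fin 3) : Phi σ ![v i, v 0, v 1, v 2] = 0 := by
    fin_cases i
    exacts [Phi_self₁₂ .., Phi_self₁₃ .., Phi_self₁₄ ..]
  have hJ' (i : Fin 3) : Phi σ ![P N₁ N₂ (v i), v 0, v 1, v 2] = 0 := by
    rw [← neg_eq_zero, ← hN, real_inner_comm, hJ]
  simp [Fin.sum_univ_succ, complexFrame, hself, hJ'] at h
  linarith

end IsUnitaryFrame

end AdaptedFrame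

section ComplexVolume

variable {σ : ℝ} {P : E8 → E8 → E8 → E8} {N₁ N₂ : E8}

/-- The Levi-Civita symbol in three indices. -/
def leviCivita (i j k : ℕ) : ℤ :=
  ((j : ℤ) - i).sign * ((k : ℤ) - i).sign * ((k : ℤ) - j).sign

/-- The real part of `(-I) ^ n`, for `n < 4`. -/
def rotationRe : ℕ → ℤ
  | 0 => 1
  | 2 => -1
  | _ => 0

/-- Minus the imaginary part of `(-I) ^ n`, for `n < 4`. -/
def rotationIm : ℕ → ℤ
  | 1 => 1
  | 3 => -1
  | _ => 0

/-- The real part of a unit complex volume form on the frame `v₀, Jv₀, v₁, Jv₁, v₂, Jv₂`. -/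
def volumeRe (i j k : Fin 6) : ℤ :=
  leviCivita (i / 2) (j / 2) (k / 2) * rotationRe (i % 2 + j % 2 + k % 2)

/-- Minus the imaginary part of a unit complex volume form on the frame
`v₀, Jv₀, v₁, Jv₁, v₂, Jv₂`. -/
def volumeIm (i j k : Fin 6) : ℤ :=
  leviCivita (i / 2) (j / 2) (k / 2) * rotationIm (i % 2 + j % 2 + k % 2)

/-- The Hermitian form `⟪x, Jy⟫` on the frame `v₀, Jv₀, v₁, Jv₁, v₂, Jv₂`. -/
def kaehlerCoeff (i j : Fin 6) : ℤ :=
  if (i : ℕ) / 2 = j / 2 then (i : ℤ) - j else 0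

theorem sum_sign_volumeRe_mul_volumeRe :
    ∑ τ : Equiv.Perm (Fin 6), (Equiv.Perm.sign τ : ℤ) *
      (volumeRe (τ 0) (τ 1) (τ 2) * volumeRe (τ 3) (τ 4) (τ 5) -
        volumeIm (τ 0) (τ 1) (τ 2) * volumeIm (τ 3) (τ 4) (τ 5)) = 0 := by
  decide +kernel

theorem sum_sign_volumeIm_mul_volumeRe :
    ∑ τ : Equiv.Perm (Fin 6), (Equiv.Perm.sign τ : ℤ) *
      (volumeIm (τ 0) (τ 1) (τ 2) * volumeRe (τ 3) (τ 4) (τ 5)) = -144 := by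
  decide +kernel

theorem sum_sign_volumeRe_mul_volumeIm :
    ∑ τ : Equiv.Perm (Fin 6), (Equiv.Perm.sign τ : ℤ) *
      (volumeRe (τ 0) (τ 1) (τ 2) * volumeIm (τ 3) (τ 4) (τ 5)) = 144 := by
  decide +kernel

theorem sum_sign_kaehlerCoeff :
    ∑ τ : Equiv.Perm (Fin 6), (Equiv.Perm.sign τ : ℤ) *
      (kaehlerCoeff (τ 0) (τ 1) * kaehlerCoeff (τ 2) (τ 3) * kaehlerCoeff (τ 4) (τ 5)) = -48 := by
  decide +kernel

/-- Two alternating trilinear forms `f` and `g` which are, up to sign, the real and imaginary part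
of a form that is complex linear for the complex structure `J` on `V`. -/
structure IsComplexVolumePair {E : Type*} (V : Set E) (J : E → E) (f g : E → E → E → ℝ) :
    Prop where
  map_mem : ∀ {x}, x ∈ V → J x ∈ V
  left_swap : ∀ x y z, f y x z = -f x y z
  left_swap' : ∀ x y z, f x z y = -f x y z
  right_swap : ∀ x y z, g y x z = -g x y z
  right_swap' : ∀ x y z, g x z y = -g x y z
  left_J : ∀ {x y z}, x ∈ V → y ∈ V → z ∈ V → f (J x) y z = g x y z
  right_J : ∀ {x y z}, x ∈ V → y ∈ V → z ∈ V → g (J x) y z = -f x y z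

namespace IsComplexVolumePair

variable {E : Type*} {V : Set E} {J : E → E} {f g : E → E → E → ℝ} {x y z : E}

theorem symm (h : IsComplexVolumePair V J f g) :
    IsComplexVolumePair V J g (fun x y z => -f x y z) where
  map_mem := h.map_mem
  left_swap := h.right_swap
  left_swap' := h.right_swap'
  right_swap x y z := by rw [h.left_swap]
  right_swap' x y z := by rw [h.left_swap']
  left_J hx hy hz := h.right_J hx hy hz
  right_J hx hy hz := by rw [h.left_J hx hy hz]

theorem left_J_mid (h : IsComplexVolumePair V J f g) (hx : x ∈ V) (hy : y ∈ V) (hz : z ∈ V) :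
    f x (J y) z = g x y z := by
  rw [h.left_swap, h.left_J hy hx hz, h.right_swap, neg_neg]

theorem left_J_last (h : IsComplexVolumePair V J f g) (hx : x ∈ V) (hy : y ∈ V) (hz : z ∈ V) :
    f x y (J z) = g x y z := by
  rw [h.left_swap', h.left_J_mid hx hz hy, h.right_swap', neg_neg]

theorem left_apply_perm (h : IsComplexVolumePair V J f g) (v : Fin 3 → E) (i j k : Fin 3) :
    f (v i) (v j) (v k) = leviCivita i j k * f (v 0) (v 1) (v 2) := by
  have h₁₂ (x y : E) : f x x y = 0 := by linarith [h.left_swap x x y]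
  have h₂₃ (x y : E) : f x y y = 0 := by linarith [h.left_swap' x y y]
  have h₁₃ (x y : E) : f x y x = 0 := by rw [h.left_swap', h₁₂, neg_zero]
  have h₀₂₁ := h.left_swap' (v 0) (v 1) (v 2)
  have h₁₀₂ := h.left_swap (v 0) (v 1) (v 2)
  have h₁₂₀ : f (v 1) (v 2) (v 0) = f (v 0) (v 1) (v 2) := by
    rw [h.left_swap', h₁₀₂, neg_neg]
  have h₂₀₁ : f (v 2) (v 0) (v 1) = f (v 0) (v 1) (v 2) := by
    rw [h.left_swap, h₀₂₁, neg_neg]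
  have h₂₁₀ : f (v 2) (v 1) (v 0) = -f (v 0) (v 1) (v 2) := by
    rw [h.left_swap', h₂₀₁]
  fin_cases i <;> fin_cases j <;> fin_cases k <;>
    simp [leviCivita, show Int.sign 2 = 1 from rfl, h₁₂, h₂₃, h₁₃, h₀₂₁, h₁₀₂, h₁₂₀, h₂₀₁, h₂₁₀]

theorem left_iterate (h : IsComplexVolumePair V J f g) (hx : x ∈ V) (hy : y ∈ V) (hz : z ∈ V)
    (p q r : Fin 2) :
    f (J^[p] x) (J^[q] y) (J^[r] z) = rotationRe (p + q + r) * f x y z +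
      rotationIm (p + q + r) * g x y z := by
  have hy' := h.map_mem hy
  have hz' := h.map_mem hz
  fin_cases p <;> fin_cases q <;> fin_cases r <;>
    simp [rotationRe, rotationIm, h.left_J, h.left_J_mid, h.left_J_last, h.symm.left_J_mid,
      h.symm.left_J_last, hx, hy, hz, hy', hz']

theorem left_complexFrame {J : E8 → E8} {V : Set E8} {f g : E8 → E8 → E8 → ℝ}
    (h : IsComplexVolumePair V J f g) {v : Fin 3 → E8} (hv : ∀ i, v i ∈ V) (i j k : Fin 6) :
    f (complexFrame J v i) (complexFrame J v j) (complexFrame J v k) =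
      volumeRe i j k * f (v 0) (v 1) (v 2) + volumeIm i j k * g (v 0) (v 1) (v 2) := by
  have hE (i : Fin 6) : complexFrame J v i =
      J^[(i.modNat (m := 3) (n := 2) : Fin 2)] (v (i.divNat (m := 3) (n := 2))) := by
    fin_cases i <;> rfl
  rw [hE, hE, hE, h.left_iterate (hv _) (hv _) (hv _), h.left_apply_perm,
    show g _ _ _ = _ from h.symm.left_apply_perm v _ _ _]
  simp only [volumeRe, volumeIm, Fin.coe_divNat, Fin.coe_modNat, Int.cast_mul]
  ring

theorem sum_sign_mul {J : E8 → E8} {V : Set E8} {f g : E8 → E8 → E8 → ℝ}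
    (h : IsComplexVolumePair V J f g) {v : Fin 3 → E8} (hv : ∀ i, v i ∈ V) :
    ∑ τ : Equiv.Perm (Fin 6), ((Equiv.Perm.sign τ : ℤ) : ℝ) *
      (f (complexFrame J v (τ 0)) (complexFrame J v (τ 1)) (complexFrame J v (τ 2)) *
        g (complexFrame J v (τ 3)) (complexFrame J v (τ 4)) (complexFrame J v (τ 5))) =
      -144 * (f (v 0) (v 1) (v 2) ^ 2 + g (v 0) (v 1) (v 2) ^ 2) := by
  have h₀ := congrArg (Int.cast (R := ℝ)) sum_sign_volumeRe_mul_volumeRe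
  have h₁ := congrArg (Int.cast (R := ℝ)) sum_sign_volumeIm_mul_volumeRe
  have h₂ := congrArg (Int.cast (R := ℝ)) sum_sign_volumeRe_mul_volumeIm
  simp only [Int.cast_sum, Int.cast_mul, Int.cast_sub] at h₀ h₁ h₂
  trans ∑ τ : Equiv.Perm (Fin 6), (((Equiv.Perm.sign τ : ℤ) : ℝ) *
      (volumeRe (τ 0) (τ 1) (τ 2) * volumeRe (τ 3) (τ 4) (τ 5) -
        volumeIm (τ 0) (τ 1) (τ 2) * volumeIm (τ 3) (τ 4) (τ 5)) *
          (f (v 0) (v 1) (v 2) * g (v 0) (v 1) (v 2)) +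
      ((Equiv.Perm.sign τ : ℤ) : ℝ) *
        (volumeIm (τ 0) (τ 1) (τ 2) * volumeRe (τ 3) (τ 4) (τ 5)) * g (v 0) (v 1) (v 2) ^ 2 -
      ((Equiv.Perm.sign τ : ℤ) : ℝ) *
        (volumeRe (τ 0) (τ 1) (τ 2) * volumeIm (τ 3) (τ 4) (τ 5)) * f (v 0) (v 1) (v 2) ^ 2)
  · refine Finset.sum_congr rfl fun τ _ => ?_
    rw [h.left_complexFrame hv, h.symm.left_complexFrame hv]
    ring
  · rw [Finset.sum_sub_distrib, Finset.sum_add_distrib, ← Finset.sum_mul, ← Finset.sum_mul,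
      ← Finset.sum_mul, h₀, h₁, h₂]
    push_cast
    ring

end IsComplexVolumePair

theorem isComplexVolumePair (hσ : σ = 1 ∨ σ = -1)
    (hP : ∀ x y z w : E8, ⟪P x y z, w⟫ = Phi σ ![x, y, z, w])
    (hN₁ : ⟪N₁, N₁⟫ = 1) (hN₂ : ⟪N₂, N₂⟫ = 1) (hN₁₂ : ⟪N₁, N₂⟫ = 0) :
    IsComplexVolumePair {x : E8 | ⟪x, N₁⟫ = 0 ∧ ⟪x, N₂⟫ = 0} (P N₁ N₂)
      (fun x y z => Phi σ ![N₁, x, y, z]) (fun x y z => -σ * Phi σ ![N₂, x, y, z]) where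
  map_mem _ := J_mem hP _
  left_swap x y z := Phi_swap₂₃ ..
  left_swap' x y z := Phi_swap₃₄ ..
  right_swap x y z := by rw [Phi_swap₂₃, mul_neg]
  right_swap' x y z := by rw [Phi_swap₃₄, mul_neg]
  left_J hx hy hz := Phi_J hσ hP hN₁ hN₁₂ hx.1 hy hz
  right_J {x y z} hx hy hz := by
    rw [← Phi_J hσ hP hN₁ hN₁₂ (J_mem hP x).1 hy hz, J_J hσ hP hN₁ hN₂ hN₁₂ hx,
      ← neg_one_smul ℝ x, Phi_swap₁₂, Phi_smul, Phi_swap₁₂]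
    ring

namespace IsUnitaryFrame

variable {v : Fin 3 → E8}

theorem inner_J_complexFrame (hv : IsUnitaryFrame P N₁ N₂ v) (hσ : σ = 1 ∨ σ = -1)
    (hP : ∀ x y z w : E8, ⟪P x y z, w⟫ = Phi σ ![x, y, z, w])
    (hN₁ : ⟪N₁, N₁⟫ = 1) (hN₂ : ⟪N₂, N₂⟫ = 1) (hN₁₂ : ⟪N₁, N₂⟫ = 0) (i j : Fin 6) :
    ⟪complexFrame (P N₁ N₂) v i, P N₁ N₂ (complexFrame (P N₁ N₂) v j)⟫ = kaehlerCoeff i j := by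
  have hJJ := hv.inner_J_J' hσ hP hN₁ hN₂ hN₁₂
  have hJ k : P N₁ N₂ (P N₁ N₂ (v k)) = -v k := J_J hσ hP hN₁ hN₂ hN₁₂ (hv.inner_normal k)
  have k' i j : ⟪P N₁ N₂ (v i), v j⟫ = 0 := by rw [real_inner_comm, hv.inner_J]
  fin_cases i <;> fin_cases j <;>
    simp [complexFrame, kaehlerCoeff, hJJ, hJ, k', hv.inner_J, hv.inner_self,
      -inner_self_eq_norm_sq_to_K]

end IsUnitaryFrame

/-- The cube of a 2-form as a sum over permutations. -/
theorem wedge_wedge_self_apply {n : ℕ} (ω : Form n 2) (x : Fin 6 → EuclideanSpace ℝ (Fin n)) :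
    (ω ⋏ ω ⋏ ω) x = (1 / 8 : ℝ) * ∑ τ : Equiv.Perm (Fin 6), ((Equiv.Perm.sign τ : ℤ) : ℝ) *
      (ω ![x (τ 0), x (τ 1)] * ω ![x (τ 2), x (τ 3)] * ω ![x (τ 4), x (τ 5)]) := by
  have h : ω ⋏ ω ⋏ ω = (1 / 8 : ℝ) • Form.alt (Form.tensor (Form.tensor ω ω) ω) := by
    simp only [Form.wedge_eq_smul_alt, Form.smul_tensor, Form.alt_smul, Form.alt_alt_tensor,
      smul_smul]
    norm_num [Nat.factorial]
  rw [h, Pi.smul_apply, smul_eq_mul]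
  congr 1
  refine Finset.sum_congr rfl fun τ _ => ?_
  congr 1
  refine congrArg₂ _ (congrArg₂ _ (congrArg ω ?_) (congrArg ω ?_)) (congrArg ω ?_) <;>
  · ext1 i
    fin_cases i <;> rfl

/-- The wedge product of two 3-forms as a sum over permutations. -/
theorem wedge_apply_three_three {n : ℕ} (α β : Form n 3)
    (x : Fin 6 → EuclideanSpace ℝ (Fin n)) :
    (α ⋏ β) x = (1 / 36 : ℝ) * ∑ τ : Equiv.Perm (Fin 6), ((Equiv.Perm.sign τ : ℤ) : ℝ) *
      (α ![x (τ 0), x (τ 1), x (τ 2)] * β ![x (τ 3), x (τ 4), x (τ 5)]) := by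
  rw [Form.wedge]
  congr 1
  · norm_num [Nat.factorial]
  refine Finset.sum_congr rfl fun τ _ => ?_
  rw [mul_assoc]
  congr 1
  refine congrArg₂ _ (congrArg α ?_) (congrArg β ?_) <;>
  · ext1 i
    fin_cases i <;> rfl

theorem IsUnitaryFrame.wedge_complexFrame {v : Fin 3 → E8} (hv : IsUnitaryFrame P N₁ N₂ v)
    (hσ : σ = 1 ∨ σ = -1)
    (hP : ∀ x y z w : E8, ⟪P x y z, w⟫ = Phi σ ![x, y, z, w])
    (hN₁ : ⟪N₁, N₁⟫ = 1) (hN₂ : ⟪N₂, N₂⟫ = 1) (hN₁₂ : ⟪N₁, N₂⟫ = 0) :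
    ((Form.iprod N₁ (Phi σ) : Form 8 3) ⋏ (Form.iprod N₂ (Phi σ) : Form 8 3))
      (complexFrame (P N₁ N₂) v) = 4 * σ := by
  have hσσ : σ * σ = 1 := by rcases hσ with rfl | rfl <;> norm_num
  have h := (isComplexVolumePair hσ hP hN₁ hN₂ hN₁₂).sum_sign_mul hv.inner_normal
  have hn : (Phi σ ![N₁, v 0, v 1, v 2]) ^ 2 + (-σ * Phi σ ![N₂, v 0, v 1, v 2]) ^ 2 = 1 := by
    rw [← hv.Phi_sq_add_Phi_sq hσ hP hN₁ hN₂ hN₁₂]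
    linear_combination (Phi σ ![N₂, v 0, v 1, v 2]) ^ 2 * hσσ
  rw [hn] at h
  rw [wedge_apply_three_three]
  calc _ = -σ / 36 * ∑ τ : Equiv.Perm (Fin 6), ((Equiv.Perm.sign τ : ℤ) : ℝ) *
        (Phi σ ![N₁, complexFrame (P N₁ N₂) v (τ 0), complexFrame (P N₁ N₂) v (τ 1),
          complexFrame (P N₁ N₂) v (τ 2)] *
        (-σ * Phi σ ![N₂, complexFrame (P N₁ N₂) v (τ 3), complexFrame (P N₁ N₂) v (τ 4),
          complexFrame (P N₁ N₂) v (τ 5)])) := by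
        rw [Finset.mul_sum, Finset.mul_sum]
        refine Finset.sum_congr rfl fun τ _ => ?_
        have hi (N x y z : E8) :
          (Form.iprod N (Phi σ) : Form 8 3) ![x, y, z] = Phi σ ![N, x, y, z] := rfl
        rw [hi, hi]
        generalize Phi σ ![N₁, _, _, _] = a
        generalize Phi σ ![N₂, _, _, _] = b
        linear_combination (-(1 / 36) * ((Equiv.Perm.sign τ : ℤ) : ℝ) * a * b) * hσσ
    _ = 4 * σ := by
        rw [h]
        ring

theorem IsUnitaryFrame.wedge_kaehler_complexFrame {v : Fin 3 → E8}
    (hv : IsUnitaryFrame P N₁ N₂ v) (hσ : σ = 1 ∨ σ = -1)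
    (hP : ∀ x y z w : E8, ⟪P x y z, w⟫ = Phi σ ![x, y, z, w])
    (hN₁ : ⟪N₁, N₁⟫ = 1) (hN₂ : ⟪N₂, N₂⟫ = 1) (hN₁₂ : ⟪N₁, N₂⟫ = 0) {ω : Form 8 2}
    (hω : ∀ v : Fin 2 → E8, ω v = ⟪v 0, P N₁ N₂ (v 1)⟫) :
    (ω ⋏ ω ⋏ ω) (complexFrame (P N₁ N₂) v) = -6 := by
  have hω' (i j : Fin 6) : ω ![complexFrame (P N₁ N₂) v i, complexFrame (P N₁ N₂) v j] =
      kaehlerCoeff i j := by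
    rw [hω]
    exact hv.inner_J_complexFrame hσ hP hN₁ hN₂ hN₁₂ i j
  have h := congrArg (Int.cast (R := ℝ)) sum_sign_kaehlerCoeff
  simp only [Int.cast_sum, Int.cast_mul] at h
  rw [wedge_wedge_self_apply]
  simp only [hω']
  rw [h]
  norm_num

/-- The interior product of `N` with the fundamental form as an alternating map. -/
theorem coe_curryLeft_PhiAlternating (N : E8) :
    ⇑((PhiAlternating σ).curryLeft N) = Form.iprod N (Phi σ) := by
  rw [← coe_PhiAlternating]
  generalize PhiAlternating σ = F
  ext x
  exact congrArg F rfl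

/-- The Hermitian form as an alternating map. -/
theorem coe_neg_curryLeft_curryLeft_PhiAlternating
    (hP : ∀ x y z w : E8, ⟪P x y z, w⟫ = Phi σ ![x, y, z, w]) {ω : Form 8 2}
    (hω : ∀ v : Fin 2 → E8, ω v = ⟪v 0, P N₁ N₂ (v 1)⟫) :
    ⇑(-((PhiAlternating σ).curryLeft N₁).curryLeft N₂) = ω := by
  ext x
  rw [hω, real_inner_comm, hP, Phi_swap₃₄, ← coe_PhiAlternating]
  refine congrArg (fun t => -PhiAlternating σ t) ?_
  ext1 i
  fin_cases i <;> rfl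

end ComplexVolume

/-- with `Jx = P(N₁,N₂,x)` and `ω(x,y) = ⟨x,Jy⟩` on
`V = {x : ⟨x,N₁⟩ = ⟨x,N₂⟩ = 0}`, for all `x₁,…,x₆ ∈ V`:
`((N₁⌟Φ)∧(N₂⌟Φ))(x₁,…,x₆) = −(2σ/3)(ω∧ω∧ω)(x₁,…,x₆)`. -/
theorem stmt19 (σ : ℝ) (hσ : σ = 1 ∨ σ = -1)
    (P : E8 → E8 → E8 → E8) (hP : ∀ x y z w : E8, ⟪P x y z, w⟫ = Phi σ ![x, y, z, w])
    (N₁ N₂ : E8) (hN₁ : ⟪N₁, N₁⟫ = 1) (hN₂ : ⟪N₂, N₂⟫ = 1) (hN₁₂ : ⟪N₁, N₂⟫ = 0)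
    (ω : Form 8 2) (hω : ∀ v : Fin 2 → E8, ω v = ⟪v 0, P N₁ N₂ (v 1)⟫)
    (x : Fin 6 → E8) (hx : ∀ k, ⟪x k, N₁⟫ = 0 ∧ ⟪x k, N₂⟫ = 0) :
    ((Form.iprod N₁ (Phi σ) : Form 8 3) ⋏ (Form.iprod N₂ (Phi σ) : Form 8 3)) x
      = -(2 * σ / 3) * (ω ⋏ ω ⋏ ω) x := by
  obtain ⟨v, hv⟩ := exists_isUnitaryFrame (N₁ := N₁) (N₂ := N₂) hP
  let F := Form.wedgeAlternating ((PhiAlternating σ).curryLeft N₁).toMultilinearMap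
    ((PhiAlternating σ).curryLeft N₂).toMultilinearMap
  let W := (-((PhiAlternating σ).curryLeft N₁).curryLeft N₂).toMultilinearMap
  let G := Form.wedgeAlternating (Form.wedgeAlternating W W).toMultilinearMap W
  have hF : ⇑F = (Form.iprod N₁ (Phi σ) : Form 8 3) ⋏ (Form.iprod N₂ (Phi σ) : Form 8 3) := by
    rw [Form.coe_wedgeAlternating, AlternatingMap.coe_multilinearMap,
      AlternatingMap.coe_multilinearMap, coe_curryLeft_PhiAlternating,
      coe_curryLeft_PhiAlternating]
  have hW : ⇑W = ω := coe_neg_curryLeft_curryLeft_PhiAlternating hP hω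
  have hG : ⇑G = ω ⋏ ω ⋏ ω := by
    rw [Form.coe_wedgeAlternating, AlternatingMap.coe_multilinearMap, Form.coe_wedgeAlternating, hW]
  have h : F (complexFrame (P N₁ N₂) v) = (-(2 * σ / 3) • G) (complexFrame (P N₁ N₂) v) := by
    rw [AlternatingMap.smul_apply, hF, hG, hv.wedge_complexFrame hσ hP hN₁ hN₂ hN₁₂,
      hv.wedge_kaehler_complexFrame hσ hP hN₁ hN₂ hN₁₂ hω, smul_eq_mul]
    ring
  have := AlternatingMap.eq_of_mem_span h fun k => hv.mem_span hσ hP hN₁ hN₂ hN₁₂ (hx k)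
  rwa [AlternatingMap.smul_apply, hF, hG, smul_eq_mul] at this
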